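/- (Mean of the GNB-BE distribution, Equation (22).) Let m > 0, a > 0, c > 0 and β be real numbers, and suppose b·c > 1. Then ∫₀^∞ m·(e^{λ} − β) · (c/B(a,b)) · e^{−bcλ} · (1 − e^{−cλ})^{a−1} dλ = (m·B(b − 1/c, a) − m·β·B(a,b)) / B(a,b). That is, the mean of the GNB-BE(m, β, a, b, c) distribution, obtained by averaging the conditional GNB mean m(e^{λ} − β) over λ distributed Beta Exponential with parameters a, b, c, equals (m B(b−1/c, a) − m β B(a,b))/B(a,b). -/

import Mathlib

open Real MeasureTheory Finset

/-- The real Beta function `B(r,s) = Γ(r)Γ(s)/Γ(r+s)`. -/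
noncomputable def betaFn (r s : ℝ) : ℝ := Real.Gamma r * Real.Gamma s / Real.Gamma (r + s)

theorem integrableOn_and_integral_rpow_mul_one_sub_rpow {r s : ℝ} (hr : 0 < r) (hs : 0 < s) :
    IntegrableOn (fun x : ℝ => x ^ (r - 1) * (1 - x) ^ (s - 1)) (Set.Ioo 0 1) ∧
      ∫ x in Set.Ioo (0 : ℝ) 1, x ^ (r - 1) * (1 - x) ^ (s - 1) = betaFn r s := by
  have hc : IntegrableOn (fun x : ℝ => (x : ℂ) ^ ((r : ℂ) - 1) * (1 - (x : ℂ)) ^ ((s : ℂ) - 1))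
      (Set.Ioo 0 1) := by
    have h := Complex.betaIntegral_convergent (u := r) (v := s) (by simpa) (by simpa)
    rwa [intervalIntegrable_iff_integrableOn_Ioo_of_le zero_le_one] at h
  have hre : Set.EqOn
      (fun x : ℝ => ((x : ℂ) ^ ((r : ℂ) - 1) * (1 - (x : ℂ)) ^ ((s : ℂ) - 1)).re)
      (fun x : ℝ => x ^ (r - 1) * (1 - x) ^ (s - 1)) (Set.Ioo 0 1) := by
    intro x hx
    have h1 : (x : ℂ) ^ ((r : ℂ) - 1) = ((x ^ (r - 1) : ℝ) : ℂ) := by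
      rw [Complex.ofReal_cpow hx.1.le]; push_cast; rfl
    have h2 : (1 - (x : ℂ)) ^ ((s : ℂ) - 1) = (((1 - x) ^ (s - 1) : ℝ) : ℂ) := by
      rw [Complex.ofReal_cpow (sub_nonneg.2 hx.2.le)]; push_cast; rfl
    simp only [h1, h2, ← Complex.ofReal_mul, Complex.ofReal_re]
  refine ⟨IntegrableOn.congr_fun hc.re hre measurableSet_Ioo, ?_⟩
  rw [← setIntegral_congr_fun measurableSet_Ioo hre]
  have h := ProbabilityTheory.beta_eq_betaIntegralReal r s hr hs
  rw [Complex.betaIntegral, intervalIntegral.integral_of_le zero_le_one,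
    integral_Ioc_eq_integral_Ioo] at h
  exact (integral_re hc).trans h.symm

theorem image_exp_neg_mul_Ioi {c : ℝ} (hc : 0 < c) :
    (fun l : ℝ => Real.exp (-(c * l))) '' Set.Ioi 0 = Set.Ioo 0 1 := by
  ext x
  constructor
  · rintro ⟨l, hl, rfl⟩
    exact ⟨Real.exp_pos _, Real.exp_lt_one_iff.2 (neg_lt_zero.2 (mul_pos hc hl))⟩
  · rintro ⟨h0, h1⟩
    refine ⟨-Real.log x / c, div_pos (neg_pos.2 (Real.log_neg h0 h1)) hc, ?_⟩
    simp only [mul_div_cancel₀ _ hc.ne', neg_neg, Real.exp_log h0]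

theorem integrableOn_and_integral_exp_mul_one_sub_exp_rpow {r s c : ℝ} (hr : 0 < r) (hs : 0 < s)
    (hc : 0 < c) :
    IntegrableOn (fun l : ℝ => c * (Real.exp (-(r * c * l)) * (1 - Real.exp (-(c * l))) ^ (s - 1)))
        (Set.Ioi 0) ∧
      ∫ l in Set.Ioi (0 : ℝ), c * (Real.exp (-(r * c * l)) * (1 - Real.exp (-(c * l))) ^ (s - 1))
        = betaFn r s := by
  have hderiv : ∀ l ∈ Set.Ioi (0 : ℝ), HasDerivWithinAt (fun l : ℝ => Real.exp (-(c * l)))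
      (Real.exp (-(c * l)) * -c) (Set.Ioi 0) l := fun l _ => by
    simpa using (((hasDerivAt_id l).const_mul c).neg.exp).hasDerivWithinAt
  have hinj : Set.InjOn (fun l : ℝ => Real.exp (-(c * l))) (Set.Ioi 0) := fun x _ y _ h =>
    mul_left_cancel₀ hc.ne' (neg_injective (Real.exp_injective h))
  have hcongr : ∀ l : ℝ,
      |Real.exp (-(c * l)) * -c| •
          (Real.exp (-(c * l)) ^ (r - 1) * (1 - Real.exp (-(c * l))) ^ (s - 1))
        = c * (Real.exp (-(r * c * l)) * (1 - Real.exp (-(c * l))) ^ (s - 1)) := fun l => by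
    have he : Real.exp (-(r * c * l)) = Real.exp (-(c * l)) * Real.exp (-(c * l)) ^ (r - 1) := by
      rw [← Real.exp_mul, ← Real.exp_add]
      congr 1
      ring
    rw [abs_mul, abs_neg, abs_of_pos hc, Real.abs_exp, he, smul_eq_mul]
    ring
  obtain ⟨hint, hval⟩ := integrableOn_and_integral_rpow_mul_one_sub_rpow hr hs
  rw [← image_exp_neg_mul_Ioi hc] at hint hval
  rw [integrableOn_image_iff_integrableOn_abs_deriv_smul measurableSet_Ioi hderiv hinj] at hint
  rw [integral_image_eq_integral_abs_deriv_smul measurableSet_Ioi hderiv hinj] at hval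
  simp only [hcongr] at hint hval
  exact ⟨hint, hval⟩

/-- Mean of the GNB-BE distribution (Equation (22)): averaging the conditional GNB
mean `m(e^λ − β)` over `λ ~ BetaExponential(a,b,c)` gives
`(m·B(b−1/c, a) − m·β·B(a,b))/B(a,b)`. -/
theorem gnb_be_mean (m β a b c : ℝ) (hm : 0 < m) (ha : 0 < a) (hc : 0 < c)
    (hbc : 1 < b * c) :
    ∫ l in Set.Ioi (0 : ℝ),
        m * (Real.exp l - β) * (c / betaFn a b) * Real.exp (-(b * c * l)) *
          (1 - Real.exp (-(c * l))) ^ (a - 1)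
      = (m * betaFn (b - 1 / c) a - m * β * betaFn a b) / betaFn a b := by
  have hr : 0 < b - 1 / c := sub_pos.2 ((div_lt_iff₀ hc).2 hbc)
  have hb : 0 < b := (one_div_pos.2 hc).trans (sub_pos.1 hr)
  obtain ⟨hint₁, hval₁⟩ := integrableOn_and_integral_exp_mul_one_sub_exp_rpow hr ha hc
  obtain ⟨hint₂, hval₂⟩ := integrableOn_and_integral_exp_mul_one_sub_exp_rpow hb ha hc
  have hsymm : betaFn b a = betaFn a b := by
    rw [betaFn, betaFn, mul_comm, add_comm]
  have hsplit : ∀ l : ℝ,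
      m * (Real.exp l - β) * (c / betaFn a b) * Real.exp (-(b * c * l)) *
          (1 - Real.exp (-(c * l))) ^ (a - 1)
        = m / betaFn a b *
            (c * (Real.exp (-((b - 1 / c) * c * l)) * (1 - Real.exp (-(c * l))) ^ (a - 1)))
          - m * β / betaFn a b *
            (c * (Real.exp (-(b * c * l)) * (1 - Real.exp (-(c * l))) ^ (a - 1))) := fun l => by
    have he : Real.exp (-((b - 1 / c) * c * l)) = Real.exp l * Real.exp (-(b * c * l)) := by
      rw [← Real.exp_add]
      congr 1
      field_simp
      ring
    rw [he]
    ring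
  simp only [hsplit]
  rw [integral_sub (hint₁.const_mul _) (hint₂.const_mul _), integral_const_mul (m / betaFn a b),
    integral_const_mul (m * β / betaFn a b), hval₁, hval₂, hsymm]
  ring
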